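/- For every n ≥ 1, the number of regions of the hyperplane arrangement K_{2n} equals the number of permutations in G^IV_{2n}; that is, r(K_{2n}) = |G^IV_{2n}|. -/

import Mathlib

/-- The complement in `ℝ^{2n+1}` of the union of the hyperplanes
`x_{2i-1} - x_{2j} = 0` (for `1 ≤ i ≤ j ≤ n`) of the arrangement `K_{2n}`.
Coordinates are 1-indexed: `x_k` is `x ⟨k-1, _⟩`. -/
def KComp (n : ℕ) : Set (Fin (2 * n + 1) → ℝ) :=
  {x | ∀ i j : ℕ, ∀ _hi : 1 ≤ i, ∀ _hij : i ≤ j, ∀ _hj : j ≤ n,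
      x ⟨2 * i - 2, by omega⟩ ≠ x ⟨2 * j - 1, by omega⟩}

/-- A permutation of `{1, …, m}` belongs to `G^IV` if:
(a) it has no even–odd ascent;
(b) it has no `Oo_d` pattern: positions `i < j` with `π_i, π_j` odd, all entries
strictly between them even, and either `j = i+1` with `π_i > π_j`, or `j > i+1`
with `π_i > max{π_{i+1}, …, π_{j-1}} > π_j`;
(c) it has no `Ee_d` pattern: positions `i < j` with `π_i, π_j` even, all entries
strictly between them odd, and either `j = i+1` with `π_i > π_j`, or `j > i+1`
with `π_i > min{π_{i+1}, …, π_{j-1}} > π_j`. -/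
def IsGIV {m : ℕ} (π : Equiv.Perm (Fin m)) : Prop :=
  (∀ i j : Fin m, (i : ℕ) + 1 = (j : ℕ) → π i < π j →
      ¬(Even ((π i : ℕ) + 1) ∧ Odd ((π j : ℕ) + 1))) ∧
  (∀ i j : Fin m, i < j → Odd ((π i : ℕ) + 1) → Odd ((π j : ℕ) + 1) →
      (∀ k : Fin m, i < k → k < j → Even ((π k : ℕ) + 1)) →
      ¬(((j : ℕ) = (i : ℕ) + 1 ∧ π j < π i) ∨
        ((i : ℕ) + 1 < (j : ℕ) ∧ (∀ k : Fin m, i < k → k < j → π k < π i) ∧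
          (∃ k : Fin m, i < k ∧ k < j ∧ π j < π k)))) ∧
  (∀ i j : Fin m, i < j → Even ((π i : ℕ) + 1) → Even ((π j : ℕ) + 1) →
      (∀ k : Fin m, i < k → k < j → Odd ((π k : ℕ) + 1)) →
      ¬(((j : ℕ) = (i : ℕ) + 1 ∧ π j < π i) ∨
        ((i : ℕ) + 1 < (j : ℕ) ∧ (∀ k : Fin m, i < k → k < j → π j < π k) ∧
          (∃ k : Fin m, i < k ∧ k < j ∧ π k < π i))))

namespace KG

def adj {m : ℕ} (u v : Fin m) : Prop :=
  (u.val % 2 = 0 ∧ v.val % 2 = 1 ∧ u.val < v.val) ∨ (u.val % 2 = 1 ∧ v.val % 2 = 0 ∧ v.val < u.val)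

structure Good {m : ℕ} (D : Fin m → Fin m → Prop) (l : Fin m → ℕ) : Prop where
  h0 : ∀ u v, D u v → adj u v
  h1 : ∀ e o, e.val % 2 = 1 → D e o → l e < l o
  h2 : ∀ o e, o.val % 2 = 0 → D o e → l o ≤ l e
  h3 : ∀ e, e.val % 2 = 1 → l e = 0 ∨ ∃ e' o, e'.val % 2 = 1 ∧ D e' o ∧ D o e ∧ l e ≤ l e' + 1
  h4 : ∀ o, o.val % 2 = 0 → (∃ e, D o e ∧ l e ≤ l o) ∨ ∀ u, l u ≤ l o
  h5 : ∀ o, o.val % 2 = 0 → l o = 0 ∨ ∃ e o', e.val % 2 = 1 ∧ D e o' ∧ l o ≤ l e + 1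

theorem Good.le_even {m : ℕ} {D : Fin m → Fin m → Prop} {l₁ l₂ : Fin m → ℕ}
    (g₁ : Good D l₁) (g₂ : Good D l₂) : ∀ k : ℕ, ∀ e, l₁ e = k → e.val % 2 = 1 → l₁ e ≤ l₂ e := by
  intro k
  induction k using Nat.strong_induction_on with
  | _ k ih =>
    intro e hk he
    rcases g₁.h3 e he with h | ⟨e', o, he', h1, h2, h3⟩
    · omega
    · have ho : o.val % 2 = 0 := by
        have := g₁.h0 _ _ h1
        unfold adj at this; omega
      have a1 := g₁.h1 _ _ he' h1
      have a2 := g₁.h2 _ _ ho h2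
      have b1 := g₂.h1 _ _ he' h1
      have b2 := g₂.h2 _ _ ho h2
      have := ih (l₁ e') (by omega) e' rfl he'
      omega

theorem Good.le {m : ℕ} {D : Fin m → Fin m → Prop} {l₁ l₂ : Fin m → ℕ}
    (g₁ : Good D l₁) (g₂ : Good D l₂) (v : Fin m) : l₁ v ≤ l₂ v := by
  have hE := g₁.le_even g₂
  rcases Nat.mod_two_eq_zero_or_one v.val with hv | hv
  · rcases g₂.h4 v hv with ⟨e, h1, h2⟩ | h
    · have he : e.val % 2 = 1 := by
        have := g₁.h0 _ _ h1
        unfold adj at this; omega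
      have := hE _ e rfl he
      have := g₁.h2 _ _ hv h1
      omega
    · rcases g₁.h5 v hv with h' | ⟨e, o, he, h1, h2⟩
      · omega
      · have := hE _ e rfl he
        have := g₂.h1 _ _ he h1
        have := h o
        omega
  · exact hE _ v rfl hv

theorem Good.unique {m : ℕ} {D : Fin m → Fin m → Prop} {l₁ l₂ : Fin m → ℕ}
    (g₁ : Good D l₁) (g₂ : Good D l₂) : l₁ = l₂ :=
  funext fun v => le_antisymm (g₁.le g₂ v) (g₂.le g₁ v)

theorem Good.tight {m : ℕ} {D : Fin m → Fin m → Prop} {l : Fin m → ℕ}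
    (g : Good D l) (v : Fin m) (hv : 0 < l v) :
    ∃ e o, e.val % 2 = 1 ∧ o.val % 2 = 0 ∧ D e o ∧ l e + 1 = l v ∧ l o = l v := by
  have key : ∀ e, e.val % 2 = 1 → 0 < l e →
      ∃ e' o, e'.val % 2 = 1 ∧ o.val % 2 = 0 ∧ D e' o ∧ l e' + 1 = l e ∧ l o = l e := by
    intro e he hl
    rcases g.h3 e he with h | ⟨e', o, he', h1, h2, h3⟩
    · omega
    · have ho : o.val % 2 = 0 := by
        have := g.h0 _ _ h1
        unfold adj at this; omega
      have := g.h1 _ _ he' h1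
      have := g.h2 _ _ ho h2
      exact ⟨e', o, he', ho, h1, by omega, by omega⟩
  rcases Nat.mod_two_eq_zero_or_one v.val with hp | hp
  · rcases g.h4 v hp with ⟨e, h1, h2⟩ | h
    · have he : e.val % 2 = 1 := by
        have := g.h0 _ _ h1
        unfold adj at this; omega
      have h3 := g.h2 _ _ hp h1
      have h4 : l e = l v := by omega
      rw [← h4]
      exact key e he (by omega)
    · rcases g.h5 v hp with h' | ⟨e, o, he, h1, h2⟩
      · omega
      · have := g.h1 _ _ he h1
        have := h o
        refine ⟨e, o, he, ?_, h1, by omega, by omega⟩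
        have := g.h0 _ _ h1
        unfold adj at this; omega
  · exact key v hp hv

/-- the sorting key -/
def key {m : ℕ} (l : Fin m → ℕ) (v : Fin m) : ℕ ×ₗ ℕ ×ₗ ℕ :=
  toLex (l v, toLex (v.val % 2, v.val))

theorem key_lt {m : ℕ} (l : Fin m → ℕ) (u v : Fin m) :
    key l u < key l v ↔ l u < l v ∨ l u = l v ∧
      (u.val % 2 < v.val % 2 ∨ u.val % 2 = v.val % 2 ∧ u.val < v.val) := by
  simp [key, Prod.Lex.toLex_lt_toLex]

theorem key_inj {m : ℕ} (l : Fin m → ℕ) : Function.Injective (key l) := by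
  intro u v h
  simp [key] at h
  exact Fin.ext h.2.2

theorem exists_sorted {m : ℕ} (l : Fin m → ℕ) :
    ∃ π : Equiv.Perm (Fin m), StrictMono (key l ∘ π) :=
  ⟨Tuple.sort (key l), (Tuple.monotone_sort (key l)).strictMono_of_injective
    ((key_inj l).comp (Equiv.injective _))⟩

theorem sorted_unique {m : ℕ} (l : Fin m → ℕ) (π σ : Equiv.Perm (Fin m))
    (h1 : StrictMono (key l ∘ π)) (h2 : StrictMono (key l ∘ σ)) : π = σ := by
  have : key l ∘ π = key l ∘ σ := by
    apply (StrictMono.range_inj h1 h2).1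
    rw [Set.range_comp, Set.range_comp, π.range_eq_univ, σ.range_eq_univ]
  ext i
  exact congrArg Fin.val (key_inj l (congrFun this i))

theorem giv_of_sorted {m : ℕ} {D : Fin m → Fin m → Prop} {l : Fin m → ℕ}
    (g : Good D l) (π : Equiv.Perm (Fin m)) (hs : StrictMono (key l ∘ π)) : IsGIV π := by
  have lt : ∀ i j, i < j → l (π i) < l (π j) ∨ l (π i) = l (π j) ∧
      ((π i).val % 2 < (π j).val % 2 ∨ (π i).val % 2 = (π j).val % 2 ∧ (π i).val < (π j).val) :=
    fun i j h => (key_lt l _ _).1 (hs h)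
  have pos : ∀ i (v : Fin m), (l (π i) < l v ∨ l (π i) = l v ∧
      ((π i).val % 2 < v.val % 2 ∨ (π i).val % 2 = v.val % 2 ∧ (π i).val < v.val)) →
      ∃ k, i < k ∧ π k = v := by
    intro i v h
    refine ⟨π.symm v, ?_, by simp⟩
    rw [← hs.lt_iff_lt]
    simpa using (key_lt l _ _).2 h
  have pos' : ∀ j (v : Fin m), (l v < l (π j) ∨ l v = l (π j) ∧
      (v.val % 2 < (π j).val % 2 ∨ v.val % 2 = (π j).val % 2 ∧ v.val < (π j).val)) →
      ∃ k, k < j ∧ π k = v := by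
    intro i v h
    refine ⟨π.symm v, ?_, by simp⟩
    rw [← hs.lt_iff_lt]
    simpa using (key_lt l _ _).2 h
  have btw : ∀ i j (v : Fin m), (l (π i) < l v ∨ l (π i) = l v ∧
      ((π i).val % 2 < v.val % 2 ∨ (π i).val % 2 = v.val % 2 ∧ (π i).val < v.val)) →
      (l v < l (π j) ∨ l v = l (π j) ∧
      (v.val % 2 < (π j).val % 2 ∨ v.val % 2 = (π j).val % 2 ∧ v.val < (π j).val)) →
      ∃ k, i < k ∧ k < j ∧ π k = v := by
    intro i j v h1 h2
    obtain ⟨k, hk, rfl⟩ := pos i v h1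
    obtain ⟨k', hk', h⟩ := pos' j _ h2
    have := π.injective h
    subst this
    exact ⟨_, hk, hk', rfl⟩
  refine ⟨?_, ?_, ?_⟩
  · rintro i j hij hlt ⟨he, ho⟩
    rw [Nat.even_iff] at he
    rw [Nat.odd_iff] at ho
    have hij' : i < j := by rw [Fin.lt_def]; omega
    have hl := lt i j hij'
    rw [Fin.lt_def] at hlt
    obtain ⟨e, o, he', ho', hD, h1, h2⟩ := g.tight (π j) (by omega)
    have hadj := g.h0 _ _ hD
    unfold adj at hadj
    have c1 : e.val ≤ (π i).val := by
      by_contra hc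
      obtain ⟨k, k1, k2, _⟩ := btw i j e (by omega) (by omega)
      rw [Fin.lt_def] at k1 k2
      omega
    have c2 : (π j).val ≤ o.val := by
      by_contra hc
      obtain ⟨k, k1, k2, _⟩ := btw i j o (by omega) (by omega)
      rw [Fin.lt_def] at k1 k2
      omega
    omega
  · intro i j hij hoi hoj hb
    rw [Nat.odd_iff] at hoi hoj
    have hl := lt i j hij
    rintro (⟨h1, h2⟩ | ⟨h1, h2, k, k1, k2, k3⟩)
    · rw [Fin.lt_def] at h2
      obtain ⟨e, o, he', ho', hD, h3, h4⟩ := g.tight (π j) (by omega)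
      obtain ⟨k, k1, k2, _⟩ := btw i j e (by omega) (by omega)
      rw [Fin.lt_def] at k1 k2
      omega
    · have hke := hb k k1 k2
      rw [Nat.even_iff] at hke
      have l1 := lt i k k1
      have l2 := lt k j k2
      rcases g.h4 (π i) (by omega) with ⟨e, h3, h4⟩ | h
      · have hadj := g.h0 _ _ h3
        have := g.h2 _ _ (by omega) h3
        unfold adj at hadj
        obtain ⟨k', q1, q2, rfl⟩ := btw i j e (by omega) (by omega)
        have := h2 k' q1 q2
        rw [Fin.lt_def] at this
        omega
      · have := h (π j)
        omega
  · intro i j hij hoi hoj hb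
    rw [Nat.even_iff] at hoi hoj
    have hl := lt i j hij
    rintro (⟨h1, h2⟩ | ⟨h1, h2, k, k1, k2, k3⟩)
    · rw [Fin.lt_def] at h2
      obtain ⟨e, o, he', ho', hD, h3, h4⟩ := g.tight (π j) (by omega)
      obtain ⟨k, k1, k2, _⟩ := btw i j o (by omega) (by omega)
      rw [Fin.lt_def] at k1 k2
      omega
    · have hke := hb k k1 k2
      rw [Nat.odd_iff] at hke
      have l1 := lt i k k1
      have l2 := lt k j k2
      rcases g.h3 (π j) (by omega) with h | ⟨e', o, he', d1, d2, h3⟩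
      · omega
      · have hadj := g.h0 _ _ d2
        have hadj1 := g.h0 _ _ d1
        unfold adj at hadj hadj1
        have := g.h1 _ _ he' d1
        have := g.h2 _ _ (by omega) d2
        obtain ⟨k', q1, q2, rfl⟩ := btw i j o (by omega) (by omega)
        have := h2 k' q1 q2
        rw [Fin.lt_def] at this
        omega

theorem exists_good {m : ℕ} (D : Fin m → Fin m → Prop) (x : Fin m → ℝ)
    (h0 : ∀ u v, D u v → adj u v) (hx : ∀ u v, D u v → x u < x v) : ∃ l, Good D l := by
  classical
  let T : Fin m → Fin m → Prop := fun a b => a.val % 2 = 1 ∧ ∃ o, D a o ∧ D o b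
  have wfx : WellFounded (fun a b : Fin m => x a < x b) := by
    have : IsTrans (Fin m) (fun a b : Fin m => x a < x b) := ⟨fun a b c h1 h2 => lt_trans h1 h2⟩
    have : Std.Irrefl (fun a b : Fin m => x a < x b) := ⟨fun a => lt_irrefl _⟩
    exact Finite.wellFounded_of_trans_of_irrefl _
  have wf : WellFounded T := by
    refine Subrelation.wf ?_ wfx
    rintro a b ⟨_, o, h1, h2⟩
    exact (hx _ _ h1).trans (hx _ _ h2)
  obtain ⟨lam, hlam⟩ : ∃ lam : Fin m → ℕ, ∀ e, lam e =
      Finset.univ.sup (fun e' => if T e' e then lam e' + 1 else 0) := by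
    refine ⟨wf.fix (fun e ih => Finset.univ.sup (fun e' => if h : T e' e then ih e' h + 1 else 0)), ?_⟩
    intro e
    rw [wf.fix_eq]
    simp only [dite_eq_ite]
  have lam1 : ∀ a b, T a b → lam a + 1 ≤ lam b := by
    intro a b h
    rw [hlam b]
    have := Finset.le_sup (f := fun e' => if T e' b then lam e' + 1 else 0) (Finset.mem_univ a)
    simpa [h] using this
  have lam2 : ∀ b, lam b = 0 ∨ ∃ a, T a b ∧ lam b = lam a + 1 := by
    intro b
    obtain ⟨a, _, ha⟩ := Finset.exists_mem_eq_sup Finset.univ ⟨b, Finset.mem_univ b⟩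
      (fun e' => if T e' b then lam e' + 1 else 0)
    rw [← hlam b] at ha
    by_cases h : T a b
    · right; exact ⟨a, h, by simpa [h] using ha⟩
    · left; simpa [h] using ha
  let P : Fin m → Prop := fun e => e.val % 2 = 1 ∧ ∃ o, D e o
  obtain ⟨S, hS⟩ : ∃ S, S = Finset.univ.sup (fun e => if P e then lam e + 1 else 0) := ⟨_, rfl⟩
  have S1 : ∀ e o, e.val % 2 = 1 → D e o → lam e + 1 ≤ S := by
    intro e o h1 h2
    have hP : P e := ⟨h1, o, h2⟩
    have := Finset.le_sup (f := fun e => if P e then lam e + 1 else 0) (Finset.mem_univ e)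
    rw [← hS] at this
    simpa [hP] using this
  have S2 : S = 0 ∨ ∃ e o, e.val % 2 = 1 ∧ D e o ∧ S = lam e + 1 := by
    rcases Nat.eq_zero_or_pos S with h | h
    · exact Or.inl h
    · right
      rcases Nat.eq_zero_or_pos m with hm | hm
      · subst hm; simp at hS; omega
      obtain ⟨a, _, ha⟩ := Finset.exists_mem_eq_sup Finset.univ ⟨⟨0, hm⟩, Finset.mem_univ _⟩
        (fun e => if P e then lam e + 1 else 0)
      rw [← hS] at ha
      by_cases hP : P a
      · obtain ⟨h1, o, h2⟩ := hP
        have hP : P a := ⟨h1, o, h2⟩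
        exact ⟨a, o, h1, h2, by simpa [hP] using ha⟩
      · simp [hP] at ha; omega
  have lamS : ∀ e, lam e ≤ S := by
    intro e
    rcases lam2 e with h | ⟨a, ⟨h1, o, h2, _⟩, h⟩
    · omega
    · have := S1 a o h1 h2
      omega
  let l : Fin m → ℕ := fun v => if v.val % 2 = 1 then lam v else
    if ∃ e, D v e then sInf {k | ∃ e, D v e ∧ lam e = k} else S
  have lE : ∀ v, v.val % 2 = 1 → l v = lam v := by
    intro v hv; simp [l, hv]
  have lO : ∀ v, v.val % 2 = 0 → (∃ e, D v e ∧ l v = lam e ∧ ∀ e', D v e' → l v ≤ lam e') ∨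
      ((∀ e, ¬ D v e) ∧ l v = S) := by
    intro v hv
    by_cases h : ∃ e, D v e
    · left
      have hl : l v = sInf {k | ∃ e, D v e ∧ lam e = k} := by simp [l, hv, h]
      have hne : {k | ∃ e, D v e ∧ lam e = k}.Nonempty := by
        obtain ⟨e, he⟩ := h
        exact ⟨lam e, e, he, rfl⟩
      obtain ⟨e, h1, h2⟩ := Nat.sInf_mem hne
      refine ⟨e, h1, by rw [hl, h2], fun e' h' => ?_⟩
      rw [hl]
      exact Nat.sInf_le ⟨e', h', rfl⟩
    · right
      push Not at h
      refine ⟨h, ?_⟩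
      simp [l, hv, h]
  have par : ∀ u v, D u v → u.val % 2 + v.val % 2 = 1 := by
    intro u v h
    have := h0 _ _ h
    unfold adj at this; omega
  refine ⟨l, h0, ?_, ?_, ?_, ?_, ?_⟩
  · intro e o he h
    have := par _ _ h
    rw [lE e he]
    rcases lO o (by omega) with ⟨e', h1, h2, _⟩ | ⟨h1, h2⟩
    · have := lam1 e e' ⟨he, o, h, h1⟩
      omega
    · have := S1 e o he h
      omega
  · intro o e ho h
    have := par _ _ h
    rw [lE e (by omega)]
    rcases lO o (by omega) with ⟨e', h1, h2, h3⟩ | ⟨h1, h2⟩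
    · exact h3 e h
    · exact absurd h (h1 e)
  · intro e he
    rw [lE e he]
    rcases lam2 e with h | ⟨a, ⟨h1, o, h2, h3⟩, h⟩
    · exact Or.inl h
    · exact Or.inr ⟨a, o, h1, h2, h3, by rw [lE a h1]; omega⟩
  · intro o ho
    rcases lO o ho with ⟨e', h1, h2, h3⟩ | ⟨h1, h2⟩
    · left
      have := par _ _ h1
      exact ⟨e', h1, by rw [lE e' (by omega)]; omega⟩
    · right
      intro u
      rw [h2]
      rcases Nat.mod_two_eq_zero_or_one u.val with hu | hu
      · rcases lO u hu with ⟨e', h1, h2, h3⟩ | ⟨h1, h2⟩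
        · rw [h2]; exact lamS _
        · omega
      · rw [lE u hu]; exact lamS _
  · intro o ho
    rcases lO o ho with ⟨e', h1, h2, h3⟩ | ⟨h1, h2⟩
    · rw [h2]
      rcases lam2 e' with h | ⟨a, ⟨h1, o, h2, h3⟩, h⟩
      · exact Or.inl h
      · exact Or.inr ⟨a, o, h1, h2, by rw [lE a h1]; omega⟩
    · rw [h2]
      rcases S2 with h | ⟨e, o', q1, q2, q3⟩
      · exact Or.inl h
      · exact Or.inr ⟨e, o', q1, q2, by rw [lE e q1]; omega⟩

/-! sequences -/

def Pt (a : ℕ → ℕ) (q : ℕ) : Prop := a q % 2 = 1 ∧ a (q + 1) % 2 = 0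

instance (a : ℕ → ℕ) : DecidablePred (Pt a) := fun q => by unfold Pt; infer_instance

theorem cnt_eq (a : ℕ → ℕ) (s t : ℕ) (hst : s ≤ t) (h : ∀ q, s ≤ q → q < t → ¬ Pt a q) :
    Nat.count (Pt a) s = Nat.count (Pt a) t := by
  induction t, hst using Nat.le_induction with
  | base => rfl
  | succ t ht ih =>
    rw [Nat.count_succ, if_neg (h t ht (by omega))]
    exact ih fun q h1 h2 => h q h1 (by omega)

theorem no_pt (a : ℕ → ℕ) (s t : ℕ) (h : Nat.count (Pt a) s = Nat.count (Pt a) t) :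
    ∀ q, s ≤ q → q < t → ¬ Pt a q := by
  intro q h1 h2 hq
  have := Nat.count_strict_mono hq h2
  have := Nat.count_monotone (Pt a) h1
  omega

theorem stay (a : ℕ → ℕ) (s t : ℕ) (hst : s ≤ t) (h : ∀ q, s ≤ q → q < t → ¬ Pt a q)
    (hs : a s % 2 = 1) : a t % 2 = 1 := by
  induction t, hst using Nat.le_induction with
  | base => exact hs
  | succ t ht ih =>
    have := ih fun q h1 h2 => h q h1 (by omega)
    have := h t ht (by omega)
    unfold Pt at this
    omega

theorem last_pt (a : ℕ → ℕ) (p : ℕ) (h : 0 < Nat.count (Pt a) p) :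
    ∃ q, q < p ∧ Pt a q ∧ Nat.count (Pt a) q + 1 = Nat.count (Pt a) p ∧
      ∀ k, q + 1 ≤ k → k < p → ¬ Pt a k := by
  induction p with
  | zero => simp at h
  | succ p ih =>
    by_cases hp : Pt a p
    · exact ⟨p, by omega, hp, by rw [Nat.count_succ, if_pos hp], by intros; omega⟩
    · rw [Nat.count_succ, if_neg hp] at h ⊢
      obtain ⟨q, h1, h2, h3, h4⟩ := ih h
      refine ⟨q, by omega, h2, h3, fun k k1 k2 => ?_⟩
      rcases Nat.lt_succ_iff_lt_or_eq.1 k2 with h | rfl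
      · exact h4 k k1 h
      · exact hp

theorem last_O (a : ℕ → ℕ) (p q : ℕ) (hpq : p ≤ q) (hp : a p % 2 = 0) :
    ∃ r, p ≤ r ∧ r ≤ q ∧ a r % 2 = 0 ∧ ∀ k, r < k → k ≤ q → a k % 2 = 1 := by
  induction q, hpq using Nat.le_induction with
  | base => exact ⟨p, le_rfl, le_rfl, hp, by intros; omega⟩
  | succ q hq ih =>
    by_cases h : a (q + 1) % 2 = 0
    · exact ⟨q + 1, by omega, le_rfl, h, by intros; omega⟩
    · obtain ⟨r, h1, h2, h3, h4⟩ := ih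
      refine ⟨r, h1, by omega, h3, fun k k1 k2 => ?_⟩
      rcases Nat.lt_or_ge q k with h' | h'
      · have hk : k = q + 1 := by omega
        rw [hk]; omega
      · exact h4 k k1 h'

structure Seq (m : ℕ) (a : ℕ → ℕ) : Prop where
  A : ∀ i, i + 1 < m → a i % 2 = 1 → a (i + 1) % 2 = 0 → a (i + 1) < a i
  S : ∀ i, i + 1 < m → a i % 2 = a (i + 1) % 2 → a i ≤ a (i + 1)
  B : ∀ i j, i + 1 < j → j < m → a i % 2 = 0 → a j % 2 = 0 →
    (∀ k, i < k → k < j → a k % 2 = 1) →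
    (∃ k, i < k ∧ k < j ∧ a i ≤ a k) ∨ (∀ k, i < k → k < j → a k ≤ a j)
  C : ∀ i j, i + 1 < j → j < m → a i % 2 = 1 → a j % 2 = 1 →
    (∀ k, i < k → k < j → a k % 2 = 0) →
    (∃ k, i < k ∧ k < j ∧ a k ≤ a j) ∨ (∀ k, i < k → k < j → a i ≤ a k)

theorem Seq.run {m : ℕ} {a : ℕ → ℕ} (h : Seq m a) (c i j : ℕ) (hij : i ≤ j) (hj : j < m)
    (hc : ∀ k, i ≤ k → k ≤ j → a k % 2 = c) : a i ≤ a j := by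
  induction j, hij using Nat.le_induction with
  | base => rfl
  | succ j hj' ih =>
    have h1 := ih (by omega) fun k k1 k2 => hc k k1 (by omega)
    have h2 := h.S j hj (by rw [hc j hj' (by omega), hc (j + 1) (by omega) le_rfl])
    omega

theorem Seq.q3 {m : ℕ} {a : ℕ → ℕ} (h : Seq m a) (p : ℕ) (hp : p < m) (he : a p % 2 = 1)
    (hc : 0 < Nat.count (Pt a) p) :
    ∃ q, q + 1 < p ∧ Pt a q ∧ a (q + 1) < a q ∧ a (q + 1) < a p ∧
      Nat.count (Pt a) q + 1 = Nat.count (Pt a) p := by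
  obtain ⟨q, h1, h2, h3, h4⟩ := last_pt a p hc
  have h2' := h2
  unfold Pt at h2'
  have hqp : q + 1 ≠ p := by rintro rfl; omega
  have hA := h.A q (by omega) h2'.1 h2'.2
  refine ⟨q, by omega, h2, hA, ?_, h3⟩
  have hex : ∃ s, q + 1 ≤ s ∧ a s % 2 = 1 := ⟨p, by omega, he⟩
  obtain ⟨s, ⟨s1, s2⟩, s3⟩ : ∃ s, (q + 1 ≤ s ∧ a s % 2 = 1) ∧ ∀ t, t < s → ¬ (q + 1 ≤ t ∧ a t % 2 = 1) :=
    ⟨Nat.find hex, Nat.find_spec hex, fun t ht => Nat.find_min hex ht⟩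
  have hsp : s ≤ p := by
    by_contra hc
    exact s3 p (by omega) ⟨by omega, he⟩
  have hsq : s ≠ q + 1 := by rintro rfl; omega
  have r1 : a s ≤ a p := h.run 1 s p hsp hp fun k k1 k2 =>
    stay a s k k1 (fun t t1 t2 => h4 t (by omega) (by omega)) s2
  have hO : ∀ k, q < k → k < s → a k % 2 = 0 := by
    intro k k1 k2
    have := s3 k k2
    omega
  rcases h.C q s (by omega) (by omega) h2'.1 s2 hO with ⟨k, k1, k2, k3⟩ | hall
  · have := h.run 0 (q + 1) k (by omega) (by omega) fun t t1 t2 => hO t (by omega) (by omega)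
    have : a (q + 1) ≠ a p := by intro h; omega
    omega
  · have := hall (q + 1) (by omega) (by omega)
    omega

theorem Seq.q4 {m : ℕ} {a : ℕ → ℕ} (h : Seq m a) (p : ℕ) (hp : p < m) (ho : a p % 2 = 0) :
    (∃ q, p < q ∧ q < m ∧ a q % 2 = 1 ∧ a p < a q ∧ Nat.count (Pt a) q = Nat.count (Pt a) p) ∨
    ∀ t, t < m → Nat.count (Pt a) t ≤ Nat.count (Pt a) p := by
  by_cases hex : ∃ q, p ≤ q ∧ q + 1 < m ∧ Pt a q
  · left
    obtain ⟨q, ⟨s1, s2, s4⟩, s3⟩ : ∃ q, (p ≤ q ∧ q + 1 < m ∧ Pt a q) ∧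
        ∀ t, t < q → ¬ (p ≤ t ∧ t + 1 < m ∧ Pt a t) :=
      ⟨Nat.find hex, Nat.find_spec hex, fun t ht => Nat.find_min hex ht⟩
    have s4' := s4
    unfold Pt at s4'
    have hpq : p ≠ q := by rintro rfl; omega
    have hno : ∀ t, p ≤ t → t < q → ¬ Pt a t := fun t t1 t2 t3 =>
      s3 t t2 ⟨t1, by omega, t3⟩
    refine ⟨q, by omega, by omega, s4'.1, ?_, (cnt_eq a p q s1 hno).symm⟩
    obtain ⟨r, r1, r2, r3, r4⟩ := last_O a p q s1 ho
    have hrq : r ≠ q := by rintro rfl; omega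
    have hA := h.A q (by omega) s4'.1 s4'.2
    have e1 : a p ≤ a r := h.run 0 p r r1 (by omega) fun k k1 k2 => by
      by_contra hk
      have := stay a k r k2 (fun t t1 t2 => hno t (by omega) (by omega)) (by omega)
      omega
    rcases h.B r (q + 1) (by omega) (by omega) r3 s4'.2
      (fun k k1 k2 => r4 k k1 (by omega)) with ⟨k, k1, k2, k3⟩ | hall
    · have := h.run 1 k q (by omega) (by omega) fun t t1 t2 => r4 t (by omega) (by omega)
      have : a p ≠ a q := by intro h; omega
      omega
    · have := hall q (by omega) (by omega)
      omega
  · right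
    intro t ht
    rcases le_total t p with h1 | h1
    · exact Nat.count_monotone _ h1
    · refine (cnt_eq a p t h1 fun q q1 q2 q3 => hex ⟨q, q1, by omega, q3⟩).ge

theorem Seq.sorted {m : ℕ} {a : ℕ → ℕ} (h : Seq m a) (i j : ℕ) (hij : i < j) (hj : j < m)
    (hne : a i ≠ a j) :
    Nat.count (Pt a) i < Nat.count (Pt a) j ∨ Nat.count (Pt a) i = Nat.count (Pt a) j ∧
      (a i % 2 < a j % 2 ∨ a i % 2 = a j % 2 ∧ a i < a j) := by
  rcases (Nat.count_monotone (Pt a) hij.le).lt_or_eq with h1 | h1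
  · exact Or.inl h1
  right
  refine ⟨h1, ?_⟩
  have hno := no_pt a i j h1
  rcases Nat.mod_two_eq_zero_or_one (a i) with hi | hi <;>
  rcases Nat.mod_two_eq_zero_or_one (a j) with hj' | hj'
  · right
    have := h.run 0 i j hij.le hj fun k k1 k2 => by
      by_contra hk
      have := stay a k j k2 (fun t t1 t2 => hno t (by omega) (by omega)) (by omega)
      omega
    omega
  · left; omega
  · have := stay a i j hij.le hno hi
    omega
  · right
    have := h.run 1 i j hij.le hj fun k k1 k2 =>
      stay a i k k1 (fun t t1 t2 => hno t (by omega) (by omega)) hi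
    omega

def sq {m : ℕ} (π : Equiv.Perm (Fin m)) (k : ℕ) : ℕ := if h : k < m then (π ⟨k, h⟩).val else 0

theorem sq_val {m : ℕ} (π : Equiv.Perm (Fin m)) (k : Fin m) : sq π k.val = (π k).val := by
  simp [sq]

theorem seq_of_giv {m : ℕ} (π : Equiv.Perm (Fin m)) (h : IsGIV π) : Seq m (sq π) := by
  obtain ⟨ha, hb, hc⟩ := h
  simp only [Nat.even_iff, Nat.odd_iff, Fin.lt_def] at ha hb hc
  have e : ∀ k (hk : k < m), sq π k = (π ⟨k, hk⟩).val := fun k hk => by simp [sq, hk]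
  have ne : ∀ i j (hi : i < m) (hj : j < m), i ≠ j → (π ⟨i, hi⟩).val ≠ (π ⟨j, hj⟩).val := by
    intro i j hi hj hij heq
    have := π.injective (Fin.ext heq)
    simp at this
    exact hij this
  refine ⟨?_, ?_, ?_, ?_⟩
  · intro i hi h1 h2
    have hi' : i < m := by omega
    rw [e i hi'] at *
    rw [e (i + 1) hi] at *
    have := ne i (i + 1) hi' hi (by omega)
    have := ha ⟨i, hi'⟩ ⟨i + 1, hi⟩ rfl
    omega
  · intro i hi h1
    have hi' : i < m := by omega
    rw [e i hi'] at *
    rw [e (i + 1) hi] at *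
    by_contra hcon
    rcases Nat.mod_two_eq_zero_or_one (π ⟨i, hi'⟩).val with h | h
    · exact hb ⟨i, hi'⟩ ⟨i + 1, hi⟩ (by simp) (by omega) (by omega)
        (fun k k1 k2 => by simp at k1 k2; omega) (Or.inl ⟨rfl, by omega⟩)
    · exact hc ⟨i, hi'⟩ ⟨i + 1, hi⟩ (by simp) (by omega) (by omega)
        (fun k k1 k2 => by simp at k1 k2; omega) (Or.inl ⟨rfl, by omega⟩)
  · intro i j hij hj h1 h2 h3
    have hi : i < m := by omega
    by_contra hcon
    push Not at hcon
    obtain ⟨q1, k, k1, k2, k3⟩ := hcon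
    have hk : k < m := by omega
    rw [e i hi] at h1
    rw [e j hj] at h2
    rw [e j hj, e k hk] at k3
    refine hb ⟨i, hi⟩ ⟨j, hj⟩ (by simp; omega) (by omega) (by omega) (fun t t1 t2 => ?_)
      (Or.inr ⟨hij, fun t t1 t2 => ?_, ⟨k, hk⟩, k1, k2, k3⟩)
    · have := h3 t t1 t2
      rw [sq_val] at this
      omega
    · have := q1 t t1 t2
      rwa [sq_val, e i hi] at this
  · intro i j hij hj h1 h2 h3
    have hi : i < m := by omega
    by_contra hcon
    push Not at hcon
    obtain ⟨q1, k, k1, k2, k3⟩ := hcon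
    have hk : k < m := by omega
    rw [e i hi] at h1
    rw [e j hj] at h2
    rw [e i hi, e k hk] at k3
    refine hc ⟨i, hi⟩ ⟨j, hj⟩ (by simp; omega) (by omega) (by omega) (fun t t1 t2 => ?_)
      (Or.inr ⟨hij, fun t t1 t2 => ?_, ⟨k, hk⟩, k1, k2, k3⟩)
    · have := h3 t t1 t2
      rw [sq_val] at this
      omega
    · have := q1 t t1 t2
      rwa [sq_val, e j hj] at this

def DP {m : ℕ} (π : Equiv.Perm (Fin m)) (u v : Fin m) : Prop :=
  adj u v ∧ π.symm u < π.symm v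

def lv {m : ℕ} (π : Equiv.Perm (Fin m)) (v : Fin m) : ℕ := Nat.count (Pt (sq π)) (π.symm v).val

theorem good_of_giv {m : ℕ} (π : Equiv.Perm (Fin m)) (h : IsGIV π) : Good (DP π) (lv π) := by
  have hs := seq_of_giv π h
  have sv : ∀ v, sq π (π.symm v).val = v.val := fun v => by rw [sq_val]; simp
  have lvq : ∀ q (hq : q < m), lv π (π ⟨q, hq⟩) = Nat.count (Pt (sq π)) q := by
    intro q hq; simp [lv]
  have e : ∀ k (hk : k < m), sq π k = (π ⟨k, hk⟩).val := fun k hk => by simp [sq, hk]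
  refine ⟨fun u v h => h.1, ?_, ?_, ?_, ?_, ?_⟩
  · rintro e o he ⟨h1, h2⟩
    have hlt := hs.sorted _ _ (Fin.lt_def.1 h2) (π.symm o).2
    rw [sv, sv] at hlt
    unfold adj at h1
    have := hlt (by omega)
    unfold lv
    omega
  · rintro o e ho ⟨h1, h2⟩
    exact Nat.count_monotone _ (Fin.lt_def.1 h2).le
  · intro v hv
    rcases Nat.eq_zero_or_pos (lv π v) with h0 | h0
    · exact Or.inl h0
    right
    obtain ⟨q, q1, q2, q3, q4, q5⟩ := hs.q3 _ (π.symm v).2 (by rw [sv]; exact hv) h0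
    have hvm := (π.symm v).2
    have hq : q < m := by omega
    have hq' : q + 1 < m := by omega
    unfold Pt at q2
    rw [sv, e _ hq'] at q4
    rw [e _ hq, e _ hq'] at q3 q2
    refine ⟨π ⟨q, hq⟩, π ⟨q + 1, hq'⟩, q2.1, ⟨?_, ?_⟩, ⟨?_, ?_⟩, ?_⟩
    · unfold adj; omega
    · simp
    · unfold adj; omega
    · simp only [Equiv.symm_apply_apply, Fin.lt_def]; exact q1
    · rw [lvq]; unfold lv; omega
  · intro v hv
    rcases hs.q4 _ (π.symm v).2 (by rw [sv]; exact hv) with ⟨q, q1, q2, q3, q4, q5⟩ | hall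
    · left
      rw [e _ q2] at q3
      rw [sv, e _ q2] at q4
      refine ⟨π ⟨q, q2⟩, ⟨?_, ?_⟩, ?_⟩
      · unfold adj; omega
      · simp only [Equiv.symm_apply_apply, Fin.lt_def]; exact q1
      · rw [lvq]; unfold lv; omega
    · right
      intro u
      exact hall _ (π.symm u).2
  · intro v hv
    rcases Nat.eq_zero_or_pos (lv π v) with h0 | h0
    · exact Or.inl h0
    right
    obtain ⟨q, q1, q2, q3, q4⟩ := last_pt _ _ h0
    have hvm := (π.symm v).2
    have hq : q < m := by omega
    have hq' : q + 1 < m := by omega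
    unfold Pt at q2
    have hA := hs.A q hq' q2.1 q2.2
    rw [e _ hq, e _ hq'] at q2 hA
    refine ⟨π ⟨q, hq⟩, π ⟨q + 1, hq'⟩, q2.1, ⟨?_, ?_⟩, ?_⟩
    · unfold adj; omega
    · simp
    · rw [lvq]; unfold lv; omega

theorem sorted_of_giv {m : ℕ} (π : Equiv.Perm (Fin m)) (h : IsGIV π) :
    StrictMono (key (lv π) ∘ π) := by
  intro i j hij
  have hs := seq_of_giv π h
  have := hs.sorted i j hij j.2
  rw [sq_val, sq_val] at this
  have := this (fun heq => hij.ne (π.injective (Fin.ext heq)))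
  rw [Function.comp, Function.comp, key_lt]
  simpa [lv] using this

theorem giv_inj {m : ℕ} (π σ : Equiv.Perm (Fin m)) (hπ : IsGIV π) (hσ : IsGIV σ)
    (h : ∀ u v, adj u v → π.symm u < π.symm v → σ.symm u < σ.symm v) : π = σ := by
  have hD : DP π = DP σ := by
    funext u v
    apply propext
    refine ⟨fun ⟨h1, h2⟩ => ⟨h1, h _ _ h1 h2⟩, fun ⟨h1, h2⟩ => ⟨h1, ?_⟩⟩
    by_contra hc
    have h1' : adj v u := by unfold adj at *; omega
    rcases (not_lt.1 hc).lt_or_eq with h3 | h3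
    · exact lt_asymm h2 (h _ _ h1' h3)
    · have := π.symm.injective h3
      subst this
      exact lt_irrefl _ h2
  have g1 := good_of_giv π hπ
  have g2 := good_of_giv σ hσ
  rw [← hD] at g2
  have hl := g1.unique g2
  have s1 := sorted_of_giv π hπ
  have s2 := sorted_of_giv σ hσ
  rw [← hl] at s2
  exact sorted_unique _ _ _ s1 s2

theorem giv_exists {m : ℕ} (x : Fin m → ℝ) (hx : ∀ u v, adj u v → x u ≠ x v) :
    ∃ π : Equiv.Perm (Fin m), IsGIV π ∧
      ∀ u v, adj u v → x u < x v → π.symm u < π.symm v := by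
  obtain ⟨l, g⟩ := exists_good (fun u v => adj u v ∧ x u < x v) x (fun u v h => h.1)
    (fun u v h => h.2)
  obtain ⟨π, hs⟩ := exists_sorted l
  refine ⟨π, giv_of_sorted g π hs, fun u v h1 h2 => ?_⟩
  rw [← hs.lt_iff_lt]
  simp only [Function.comp, Equiv.apply_symm_apply]
  rw [key_lt]
  have h1' := h1
  unfold adj at h1'
  rcases Nat.mod_two_eq_zero_or_one u.val with hu | hu
  · have := g.h2 u v hu ⟨h1, h2⟩
    omega
  · have := g.h1 u v hu ⟨h1, h2⟩
    omega

/-! topology -/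

theorem mem_K (n : ℕ) (x : Fin (2 * n + 1) → ℝ) :
    x ∈ KComp n ↔ ∀ u v : Fin (2 * n), adj u v → x u.castSucc ≠ x v.castSucc := by
  constructor
  · intro h u v huv
    have hu := u.2
    have hv := v.2
    rcases huv with ⟨h1, h2, h3⟩ | ⟨h1, h2, h3⟩
    · have := h (u.val / 2 + 1) (v.val / 2 + 1) (by omega) (by omega) (by omega)
      convert this using 2 <;> (apply Fin.ext; simp; omega)
    · have := (h (v.val / 2 + 1) (u.val / 2 + 1) (by omega) (by omega) (by omega)).symm
      convert this using 2 <;> (apply Fin.ext; simp; omega)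
  · intro h i j hi hij hj
    exact h ⟨2 * i - 2, by omega⟩ ⟨2 * j - 1, by omega⟩ (by unfold adj; simp only; omega)

theorem comp_inj (n : ℕ) (x y : KComp n)
    (h : (x : ConnectedComponents (KComp n)) = y) (u v : Fin (2 * n)) (huv : adj u v)
    (hx : x.1 u.castSucc < x.1 v.castSucc) : y.1 u.castSucc < y.1 v.castSucc := by
  by_contra hc
  rw [ConnectedComponents.coe_eq_coe] at h
  have hp : IsPreconnected (connectedComponent x) := isPreconnected_connectedComponent
  have hy : y ∈ connectedComponent x := by rw [h]; exact mem_connectedComponent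
  have hcont : ContinuousOn (fun z : KComp n => z.1 u.castSucc - z.1 v.castSucc)
      (connectedComponent x) := by
    apply Continuous.continuousOn
    exact ((continuous_apply u.castSucc).comp continuous_subtype_val).sub
      ((continuous_apply v.castSucc).comp continuous_subtype_val)
  have := hp.intermediate_value mem_connectedComponent hy hcont
  obtain ⟨z, _, hz⟩ := this (show (0 : ℝ) ∈ _ from ⟨by linarith, by linarith⟩)
  exact (mem_K n z.1).1 z.2 u v huv (sub_eq_zero.1 hz)

theorem comp_eq (n : ℕ) (x y : KComp n)
    (h : ∀ u v : Fin (2 * n), adj u v → x.1 u.castSucc < x.1 v.castSucc →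
      y.1 u.castSucc < y.1 v.castSucc) :
    (x : ConnectedComponents (KComp n)) = y := by
  rw [ConnectedComponents.coe_eq_coe]
  let S : Set (Fin (2 * n + 1) → ℝ) := {z | ∀ u v : Fin (2 * n), adj u v →
    x.1 u.castSucc < x.1 v.castSucc → z u.castSucc < z v.castSucc}
  have hS : Convex ℝ S := by
    intro a ha b hb s t hs ht hst u v huv hx
    have h1 := ha u v huv hx
    have h2 := hb u v huv hx
    simp only [Pi.add_apply, Pi.smul_apply, smul_eq_mul]
    rcases hs.eq_or_lt with h0 | h0
    · subst h0
      have : t = 1 := by linarith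
      subst this
      simpa using h2
    · have := mul_lt_mul_of_pos_left h1 h0
      have := mul_le_mul_of_nonneg_left h2.le ht
      linarith
  have hSK : S ⊆ KComp n := by
    intro z hz
    rw [mem_K]
    intro u v huv
    have huv' : adj v u := by unfold adj at *; omega
    rcases lt_or_gt_of_ne ((mem_K n x.1).1 x.2 u v huv) with h1 | h1
    · exact (hz u v huv h1).ne
    · exact (hz v u huv' h1).ne'
  have hpre : IsPreconnected ((Subtype.val : KComp n → _) ⁻¹' S) := by
    rw [← Topology.IsInducing.subtypeVal.isPreconnected_image, Subtype.image_preimage_coe,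
      Set.inter_eq_right.2 hSK]
    exact hS.isPreconnected
  have hx : x ∈ (Subtype.val : KComp n → _) ⁻¹' S := fun u v _ h => h
  have hy : y ∈ (Subtype.val : KComp n → _) ⁻¹' S := h
  exact connectedComponent_eq (hpre.subset_connectedComponent hx hy)

def pt {n : ℕ} (π : Equiv.Perm (Fin (2 * n))) : Fin (2 * n + 1) → ℝ :=
  fun k => if h : k.val < 2 * n then ((π.symm ⟨k.val, h⟩).val : ℝ) else 0

theorem pt_lt {n : ℕ} (π : Equiv.Perm (Fin (2 * n))) (u v : Fin (2 * n)) :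
    pt π u.castSucc < pt π v.castSucc ↔ π.symm u < π.symm v := by
  simp [pt]

theorem pt_mem {n : ℕ} (π : Equiv.Perm (Fin (2 * n))) : pt π ∈ KComp n := by
  rw [mem_K]
  intro u v huv h
  have : u = v := by
    apply π.symm.injective
    apply le_antisymm
    · exact not_lt.1 fun hc => ((pt_lt π v u).2 hc).ne' h
    · exact not_lt.1 fun hc => ((pt_lt π u v).2 hc).ne h
  subst this
  unfold adj at huv
  omega

end KG

/-- For every `n ≥ 1`, the number of regions of the hyperplane arrangement
`K_{2n}` equals the number of permutations in `G^IV_{2n}`. -/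
theorem regions_K_eq_card_GIV (n : ℕ) (hn : 1 ≤ n) :
    Nat.card (ConnectedComponents ↥(KComp n)) =
      Nat.card {π : Equiv.Perm (Fin (2 * n)) // IsGIV π} := by
  symm
  apply Nat.card_eq_of_bijective
    (fun π : {π : Equiv.Perm (Fin (2 * n)) // IsGIV π} =>
      ((⟨KG.pt π.1, KG.pt_mem π.1⟩ : KComp n) : ConnectedComponents (KComp n)))
  constructor
  · intro π σ h
    apply Subtype.ext
    apply KG.giv_inj _ _ π.2 σ.2
    intro u v huv hlt
    have := KG.comp_inj n _ _ h u v huv ((KG.pt_lt _ _ _).2 hlt)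
    exact (KG.pt_lt _ _ _).1 this
  · intro c
    obtain ⟨x, rfl⟩ := ConnectedComponents.surjective_coe c
    obtain ⟨π, h1, h2⟩ := KG.giv_exists (fun v : Fin (2 * n) => x.1 v.castSucc)
      ((KG.mem_K n x.1).1 x.2)
    refine ⟨⟨π, h1⟩, ?_⟩
    symm
    apply KG.comp_eq
    intro u v huv hlt
    exact (KG.pt_lt _ _ _).2 (h2 u v huv hlt)
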